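/- For n > 2, the kernel of the adjoint representation Ad: L(n) → Der(L(n)), X ↦ [X, -], is the free abelian group of rank 1 generated by Δ(n) in degree 1; i.e., the center of L(n) equals ℤ·Δ(n). -/

import Mathlib

open FreeLieAlgebra

/-- Index set for the generators `B_{i,j}`, `1 ≤ i < j ≤ n`, of the pure braid Lie algebra. -/
abbrev PBGen (n : ℕ) : Type := {p : Fin n × Fin n // p.1 < p.2}

/-- The generator `B_{i,j}` in the free Lie algebra, with the convention `B_{j,i} = B_{i,j}`
(and `B_{i,i} = 0`, never used). -/
noncomputable def Bpre {n : ℕ} (i j : Fin n) : FreeLieAlgebra ℤ (PBGen n) :=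
  if h : i < j then FreeLieAlgebra.of ℤ ⟨(i, j), h⟩
  else if h' : j < i then FreeLieAlgebra.of ℤ ⟨(j, i), h'⟩ else 0

/-- The infinitesimal braid relations. -/
def pbRelations (n : ℕ) : Set (FreeLieAlgebra ℤ (PBGen n)) :=
  {x | ∃ i j s t : Fin n, ({i, j} ∩ {s, t} : Set (Fin n)) = ∅ ∧
      x = ⁅Bpre i j, Bpre s t⁆} ∪
  {x | ∃ i j s : Fin n, i ≠ j ∧ j ≠ s ∧ i ≠ s ∧
      x = ⁅Bpre i j, Bpre i s + Bpre s j⁆}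

/-- The Lie ideal generated by the infinitesimal braid relations. -/
noncomputable def pbIdeal (n : ℕ) : LieIdeal ℤ (FreeLieAlgebra ℤ (PBGen n)) :=
  LieSubmodule.lieSpan ℤ (FreeLieAlgebra ℤ (PBGen n)) (pbRelations n)

/-- `L(n)`, the holonomy Lie algebra of the pure braid arrangement. -/
abbrev LnAlg (n : ℕ) : Type := FreeLieAlgebra ℤ (PBGen n) ⧸ pbIdeal n

/-- The class of `B_{i,j}` in `L(n)`. -/
noncomputable def Bq {n : ℕ} (i j : Fin n) : LnAlg n :=
  LieSubmodule.Quotient.mk' (pbIdeal n) (Bpre i j)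

/-- `Δ(n) = Σ_{1 ≤ i < j ≤ n} B_{i,j}` in `L(n)`. -/
noncomputable def Delta (n : ℕ) : LnAlg n :=
  ∑ p : PBGen n, LieSubmodule.Quotient.mk' (pbIdeal n) (FreeLieAlgebra.of ℤ p)

namespace FreeLieAlgebra

universe u v

section Induction

variable {R : Type u} {X : Type v} [CommRing R]

theorem induction {p : FreeLieAlgebra R X → Prop} (zero : p 0) (of : ∀ x, p (of R x))
    (add : ∀ a b, p a → p b → p (a + b)) (smul : ∀ (c : R) a, p a → p (c • a))
    (lie : ∀ a b, p a → p b → p ⁅a, b⁆) (z : FreeLieAlgebra R X) : p z := by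
  let K : LieSubalgebra R (FreeLieAlgebra R X) :=
    { carrier := {z | p z}
      zero_mem' := zero
      add_mem' := fun {a b} => add a b
      smul_mem' := fun c a => smul c a
      lie_mem' := fun {a b} => lie a b }
  let φ : FreeLieAlgebra R X →ₗ⁅R⁆ K := lift R fun x => ⟨FreeLieAlgebra.of R x, of x⟩
  have h : K.incl.comp φ = LieHom.id := by
    ext x
    simp [φ]
  have hz : ((φ z : K) : FreeLieAlgebra R X) = z := LieHom.congr_fun h z
  rw [← hz]
  exact (φ z).2

theorem eq_zero_of_smul_of_add_smul_of_eq_zero {x y : X} (hxy : x ≠ y) {a b : R}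
    (h : a • of R x + b • of R y = 0) : a = 0 := by
  classical
  let := LieRing.ofAssociativeRing (A := R)
  let := LieAlgebra.ofAssociativeAlgebra (A := R) (R := R)
  have := congrArg (lift R (Pi.single x (1 : R))) h
  simpa [hxy.symm] using this

/-- The extension of a map on generators to a derivation of the free Lie algebra. -/
noncomputable def derivation (f : X → FreeLieAlgebra R X) :
    LieDerivation R (FreeLieAlgebra R X) (FreeLieAlgebra R X) :=
  let φ : FreeLieAlgebra R X →ₗ⁅R⁆
      LieAlgebra.ofTwoCocycle
        (0 : LieModule.Cohomology.twoCocycle R (FreeLieAlgebra R X) (FreeLieAlgebra R X)) :=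
    lift R fun x => ⟨(of R x, f x)⟩
  have hφ (z) : (φ z).carrier.1 = z := by
    induction z using FreeLieAlgebra.induction with
    | zero => rw [map_zero]; rfl
    | of x => simp [φ]
    | add a b ha hb => rw [map_add]; exact congrArg₂ _ ha hb
    | smul c a ha => rw [map_smul]; exact congrArg _ ha
    | lie a b ha hb => rw [LieHom.map_lie]; exact congrArg₂ _ ha hb
  { toFun := fun z => (φ z).carrier.2
    map_add' := fun a b => by rw [map_add]; rfl
    map_smul' := fun c a => by rw [map_smul]; rfl
    leibniz' := fun a b => by
      have : (φ ⁅a, b⁆).carrier.2 =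
        0 + ⁅(φ a).carrier.1, (φ b).carrier.2⁆ - ⁅(φ b).carrier.1, (φ a).carrier.2⁆ := by
          rw [LieHom.map_lie]; rfl
      rw [hφ, hφ, zero_add] at this
      exact this }

@[simp]
theorem derivation_of (f : X → FreeLieAlgebra R X) (x : X) : derivation f (of R x) = f x := by
  simp [derivation]

/-- `LengthLE d z` says that `z` is a linear combination of brackets of at most `d` generators. -/
inductive LengthLE : ℕ → FreeLieAlgebra R X → Prop
  | zero (d : ℕ) : LengthLE d 0
  | of (d : ℕ) (x : X) : LengthLE (d + 1) (of R x)
  | add {d : ℕ} {a b : FreeLieAlgebra R X} : LengthLE d a → LengthLE d b → LengthLE d (a + b)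
  | smul {d : ℕ} (c : R) {a : FreeLieAlgebra R X} : LengthLE d a → LengthLE d (c • a)
  | lie_succ {d e : ℕ} {a b : FreeLieAlgebra R X} :
      LengthLE (d + 1) a → LengthLE (e + 1) b → LengthLE (d + e + 2) ⁅a, b⁆

namespace LengthLE

theorem mono {d : ℕ} {z : FreeLieAlgebra R X} (h : LengthLE d z) :
    ∀ {e : ℕ}, d ≤ e → LengthLE e z := by
  induction h with
  | zero => exact fun _ => .zero _
  | of d x =>
    intro e he
    obtain ⟨k, rfl⟩ := Nat.exists_eq_add_of_le' (Nat.one_le_of_lt he)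
    exact .of k x
  | add _ _ iha ihb => exact fun he => (iha he).add (ihb he)
  | smul c _ ih => exact fun he => (ih he).smul c
  | @lie_succ d e a b _ _ iha ihb =>
    intro m hm
    obtain ⟨k, rfl⟩ := Nat.exists_eq_add_of_le hm
    rw [show d + e + 2 + k = (d + k) + e + 2 by omega]
    exact (iha (by omega)).lie_succ (ihb le_rfl)

theorem eq_zero {z : FreeLieAlgebra R X} (h : LengthLE 0 z) : z = 0 := by
  generalize hd : 0 = d at h
  induction h with
  | zero => rfl
  | of d x => omega
  | add _ _ iha ihb => rw [iha hd, ihb hd, add_zero]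
  | smul c _ ih => rw [ih hd, smul_zero]
  | lie_succ => omega

theorem lie {d e : ℕ} {a b : FreeLieAlgebra R X} (ha : LengthLE d a) (hb : LengthLE e b) :
    LengthLE (d + e) ⁅a, b⁆ := by
  obtain _ | d := d
  · rw [ha.eq_zero, zero_lie]; exact .zero _
  obtain _ | e := e
  · rw [hb.eq_zero, lie_zero]; exact .zero _
  rw [show d + 1 + (e + 1) = d + e + 2 by omega]
  exact ha.lie_succ hb

theorem neg {d : ℕ} {a : FreeLieAlgebra R X} (ha : LengthLE d a) : LengthLE d (-a) := by
  rw [← neg_one_smul R a]; exact ha.smul _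

theorem sub {d : ℕ} {a b : FreeLieAlgebra R X} (ha : LengthLE d a) (hb : LengthLE d b) :
    LengthLE d (a - b) := by
  rw [sub_eq_add_neg]; exact ha.add hb.neg

theorem exists_lengthLE (z : FreeLieAlgebra R X) : ∃ d, LengthLE d z := by
  induction z using FreeLieAlgebra.induction with
  | zero => exact ⟨0, .zero _⟩
  | of x => exact ⟨1, .of 0 x⟩
  | add a b ha hb =>
    obtain ⟨d, ha⟩ := ha
    obtain ⟨e, hb⟩ := hb
    exact ⟨d + e, (ha.mono (by omega)).add (hb.mono (by omega))⟩
  | smul c a ha =>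
    obtain ⟨d, ha⟩ := ha
    exact ⟨d, ha.smul c⟩
  | lie a b ha hb =>
    obtain ⟨d, ha⟩ := ha
    obtain ⟨e, hb⟩ := hb
    exact ⟨d + e, ha.lie hb⟩

theorem derivation_apply {f : X → FreeLieAlgebra R X} (hf : ∀ x, LengthLE 1 (f x)) {d : ℕ}
    {z : FreeLieAlgebra R X} (hz : LengthLE d z) : LengthLE d (derivation f z) := by
  induction hz with
  | zero => simpa using .zero _
  | of d x => simpa using (hf x).mono (by omega)
  | add _ _ iha ihb => simpa using iha.add ihb
  | smul c _ ih => simpa using ih.smul c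
  | @lie_succ d e a b ha hb iha ihb =>
    rw [LieDerivation.apply_lie_eq_sub]
    exact (ha.lie_succ ihb).sub ((hb.lie_succ iha).mono (by omega))

end LengthLE

end Induction

section Elimination

variable {R : Type u} {X : Type v} [CommRing R]

open Classical in
/-- The endomorphism killing the generators in `T` and fixing the others. -/
noncomputable def kill (T : Set X) : FreeLieAlgebra R X →ₗ⁅R⁆ FreeLieAlgebra R X :=
  lift R fun x => if x ∈ T then 0 else of R x

theorem kill_insert (t : X) (T : Set X) (z : FreeLieAlgebra R X) :
    kill (insert t T) z = kill {t} (kill T z) := by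
  have : (kill (insert t T) : FreeLieAlgebra R X →ₗ⁅R⁆ _) = (kill {t}).comp (kill T) := by
    ext x
    by_cases hT : x ∈ T
    · simp [kill, hT]
    · by_cases ht : x = t
      · subst ht; simp [kill, hT]
      · simp [kill, hT, ht]
  rw [this]; rfl

theorem exists_finset_forall_eqOn (z : FreeLieAlgebra R X) :
    ∃ S : Finset X, ∀ φ ψ : FreeLieAlgebra R X →ₗ⁅R⁆ FreeLieAlgebra R X,
      (∀ x ∈ S, φ (of R x) = ψ (of R x)) → φ z = ψ z := by
  classical
  induction z using FreeLieAlgebra.induction with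
  | zero => exact ⟨∅, by simp⟩
  | of x => exact ⟨{x}, by simp⟩
  | add a b ha hb =>
    obtain ⟨S, hS⟩ := ha
    obtain ⟨T, hT⟩ := hb
    refine ⟨S ∪ T, fun φ ψ h => ?_⟩
    rw [map_add, map_add, hS φ ψ fun x hx => h x (by simp [hx]),
      hT φ ψ fun x hx => h x (by simp [hx])]
  | smul c a ha =>
    obtain ⟨S, hS⟩ := ha
    refine ⟨S, fun φ ψ h => ?_⟩
    rw [map_smul, map_smul, hS φ ψ h]
  | lie a b ha hb =>
    obtain ⟨S, hS⟩ := ha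
    obtain ⟨T, hT⟩ := hb
    refine ⟨S ∪ T, fun φ ψ h => ?_⟩
    rw [LieHom.map_lie, LieHom.map_lie, hS φ ψ fun x hx => h x (by simp [hx]),
      hT φ ψ fun x hx => h x (by simp [hx])]

theorem exists_eq_smul_of_forall_mem (x : X) {φ : FreeLieAlgebra R X →ₗ⁅R⁆ FreeLieAlgebra R X}
    (h : ∀ y, ∃ c : R, φ (of R y) = c • of R x) (z : FreeLieAlgebra R X) :
    ∃ c : R, φ z = c • of R x := by
  induction z using FreeLieAlgebra.induction with
  | zero => exact ⟨0, by simp⟩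
  | of y => exact h y
  | add a b ha hb =>
    obtain ⟨c, ha⟩ := ha
    obtain ⟨d, hb⟩ := hb
    exact ⟨c + d, by rw [map_add, ha, hb, add_smul]⟩
  | smul c a ha =>
    obtain ⟨d, ha⟩ := ha
    exact ⟨c * d, by rw [map_smul, ha, mul_smul]⟩
  | lie a b ha hb =>
    obtain ⟨c, ha⟩ := ha
    obtain ⟨d, hb⟩ := hb
    exact ⟨0, by rw [LieHom.map_lie, ha, hb]; simp⟩

theorem exists_eq_smul_of_kill_eq {x : X} {z : FreeLieAlgebra R X}
    (h : ∀ t, t ≠ x → kill {t} z = z) : ∃ c : R, z = c • of R x := by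
  classical
  have key (T : Finset X) (hT : x ∉ T) : kill (T : Set X) z = z := by
    induction T using Finset.induction_on with
    | empty =>
      have : (kill ((∅ : Finset X) : Set X) : FreeLieAlgebra R X →ₗ⁅R⁆ _) = LieHom.id := by
        ext y; simp [kill]
      rw [this]; rfl
    | insert t T _ ih =>
      rw [Finset.coe_insert, kill_insert, ih (by grind), h t (by grind)]
  obtain ⟨S, hS⟩ := exists_finset_forall_eqOn z
  have h1 := hS (kill (S.erase x : Finset X)) (kill {x}ᶜ) fun y hy => by
    by_cases hyx : y = x <;> simp [kill, hyx, hy]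
  rw [key _ (by simp)] at h1
  rw [h1]
  refine exists_eq_smul_of_forall_mem x (fun y => ?_) z
  by_cases hyx : y = x
  · exact ⟨1, by simp [kill, hyx]⟩
  · exact ⟨0, by simp [kill, hyx]⟩

/-- The free generators `ad(t)^k x` of the elimination ideal for the generator `t`. -/
abbrev ElimGen (t : X) : Type v := {x : X // x ≠ t} × ℕ

variable (R) in
/-- The derivation of the elimination ideal given by `ad t`. -/
noncomputable def elimShift (t : X) :
    LieDerivation R (FreeLieAlgebra R (ElimGen t)) (FreeLieAlgebra R (ElimGen t)) :=
  derivation fun y => of R (y.1, y.2 + 1)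

variable (R) in
/-- The inclusion of the elimination ideal. -/
noncomputable def elimIncl (t : X) : FreeLieAlgebra R (ElimGen t) →ₗ⁅R⁆ FreeLieAlgebra R X :=
  lift R fun y => (fun z => ⁅of R t, z⁆)^[y.2] (of R y.1)

open Classical in
variable (R) in
/-- The map to the semidirect product witnessing injectivity of `elimIncl`. -/
noncomputable def elimSplit (t : X) :
    FreeLieAlgebra R X →ₗ⁅R⁆ (FreeLieAlgebra R (ElimGen t)) ⋊⁅LieHom.id⁆
      (LieDerivation R (FreeLieAlgebra R (ElimGen t)) (FreeLieAlgebra R (ElimGen t))) :=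
  lift R fun x => if h : x = t then ⟨0, elimShift R t⟩ else ⟨of R (⟨x, h⟩, 0), 0⟩

open Classical in
variable (R) in
/-- The homomorphism killing `t` and sending the other generators to the corresponding generators
of the elimination ideal. -/
noncomputable def elimRetract (t : X) :
    FreeLieAlgebra R X →ₗ⁅R⁆ FreeLieAlgebra R (ElimGen t) :=
  lift R fun x => if h : x = t then 0 else of R (⟨x, h⟩, 0)

variable {t : X}

theorem elimSplit_of_self : elimSplit R t (of R t) = ⟨0, elimShift R t⟩ := by
  simp [elimSplit]

theorem elimSplit_of_ne {x : X} (h : x ≠ t) :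
    elimSplit R t (of R x) = ⟨of R (⟨x, h⟩, 0), 0⟩ := by
  simp [elimSplit, h]

theorem elimSplit_elimIncl (g : FreeLieAlgebra R (ElimGen t)) :
    elimSplit R t (elimIncl R t g) = ⟨g, 0⟩ := by
  have : (elimSplit R t).comp (elimIncl R t) = LieAlgebra.SemiDirectSum.inl LieHom.id := by
    ext ⟨⟨x, hx⟩, k⟩ : 1
    rw [LieHom.comp_apply, LieAlgebra.SemiDirectSum.inl_eq_mk]
    rw [elimIncl, lift_of_apply]
    induction k with
    | zero => exact elimSplit_of_ne hx
    | succ k ih =>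
      dsimp only at ih ⊢
      rw [Function.iterate_succ_apply', LieHom.map_lie, ih, elimSplit_of_self]
      simp [elimShift]
  exact LieHom.congr_fun this g

theorem elimIncl_elimShift (g : FreeLieAlgebra R (ElimGen t)) :
    elimIncl R t (elimShift R t g) = ⁅of R t, elimIncl R t g⁆ := by
  induction g using FreeLieAlgebra.induction with
  | zero => simp
  | of x => simp only [elimIncl, elimShift, derivation_of, lift_of_apply,
      Function.iterate_succ_apply']
  | add a b ha hb => simp only [map_add, ha, hb, lie_add]
  | smul c a ha => simp only [map_smul, ha, lie_smul]
  | lie a b ha hb =>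
    rw [LieDerivation.apply_lie_eq_add, map_add, LieHom.map_lie, LieHom.map_lie, LieHom.map_lie,
      ha, hb, leibniz_lie (of R t), add_comm]

theorem exists_eq_smul_add_elimIncl (t : X) (z : FreeLieAlgebra R X) :
    ∃ (c : R) (g : FreeLieAlgebra R (ElimGen t)), z = c • of R t + elimIncl R t g := by
  induction z using FreeLieAlgebra.induction with
  | zero => exact ⟨0, 0, by simp⟩
  | of x =>
    by_cases h : x = t
    · exact ⟨1, 0, by simp [h]⟩
    · exact ⟨0, of R (⟨x, h⟩, 0), by simp [elimIncl]⟩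
  | add a b ha hb =>
    obtain ⟨c, g, rfl⟩ := ha
    obtain ⟨d, h, rfl⟩ := hb
    exact ⟨c + d, g + h, by rw [map_add]; module⟩
  | smul c a ha =>
    obtain ⟨d, g, rfl⟩ := ha
    exact ⟨c * d, c • g, by rw [map_smul]; module⟩
  | lie a b ha hb =>
    obtain ⟨c, g, rfl⟩ := ha
    obtain ⟨d, h, rfl⟩ := hb
    refine ⟨0, c • elimShift R t h - d • elimShift R t g + ⁅g, h⁆, ?_⟩
    simp only [map_add, map_sub, map_smul, LieHom.map_lie, elimIncl_elimShift, lie_add, add_lie,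
      lie_smul, smul_lie, lie_self, smul_zero, zero_smul]
    rw [← lie_skew (of R t) (elimIncl R t g)]
    simp only [smul_neg]
    abel_nf

theorem elimIncl_elimRetract (z : FreeLieAlgebra R X) :
    elimIncl R t (elimRetract R t z) = kill {t} z := by
  have : (elimIncl R t).comp (elimRetract R t) = kill {t} := by
    ext x
    by_cases h : x = t <;> simp [elimIncl, elimRetract, kill, h]
  exact LieHom.congr_fun this z

theorem elimRetract_kill (z : FreeLieAlgebra R X) :
    elimRetract R t (kill {t} z) = elimRetract R t z := by
  have : (elimRetract R t).comp (kill {t}) = elimRetract R t := by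
    ext x
    by_cases h : x = t <;> simp [elimRetract, kill, h]
  exact LieHom.congr_fun this z

theorem LengthLE.elimSplit {d : ℕ} {z : FreeLieAlgebra R X} (hz : LengthLE d z) :
    LengthLE d (elimSplit R t z).left ∧
    LengthLE (d - 1) ((FreeLieAlgebra.elimSplit R t z).left - elimRetract R t z) ∧
    ∀ e h, LengthLE e h → LengthLE e ((FreeLieAlgebra.elimSplit R t z).right h) := by
  induction hz with
  | zero => simp [LengthLE.zero]
  | of d x =>
    by_cases h : x = t
    · subst h
      rw [elimSplit_of_self]
      refine ⟨.zero _, by simp [elimRetract, LengthLE.zero], fun e y hy => ?_⟩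
      exact hy.derivation_apply fun y => .of 0 _
    · rw [elimSplit_of_ne h]
      exact ⟨.of _ _, by simpa [elimRetract, h] using .zero _, fun e y hy => .zero _⟩
  | @add d a b _ _ iha ihb =>
    rw [map_add, map_add, LieAlgebra.SemiDirectSum.add_eq_mk]
    refine ⟨iha.1.add ihb.1, ?_, fun e h hh => (iha.2.2 e h hh).add (ihb.2.2 e h hh)⟩
    rw [add_sub_add_comm]
    exact iha.2.1.add ihb.2.1
  | @smul d c a _ ih =>
    rw [map_smul, map_smul, LieAlgebra.SemiDirectSum.smul_eq_mk]
    refine ⟨ih.1.smul c, ?_, fun e h hh => (ih.2.2 e h hh).smul c⟩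
    rw [← smul_sub]
    exact ih.2.1.smul c
  | @lie_succ d e a b _ _ iha ihb =>
    rw [LieHom.map_lie, LieHom.map_lie, LieAlgebra.SemiDirectSum.lie_eq_mk]
    generalize FreeLieAlgebra.elimSplit R t a = A at *
    generalize FreeLieAlgebra.elimSplit R t b = B at *
    generalize elimRetract R t a = r at *
    generalize elimRetract R t b = s at *
    obtain ⟨ha, hr, ha'⟩ := iha
    obtain ⟨hb, hs, hb'⟩ := ihb
    simp only [LieHom.id_apply]
    have h1 := (ha' _ _ hb)
    have h2 := (hb' _ _ ha)
    refine ⟨((ha.lie_succ hb).add (h1.mono (by omega))).sub (h2.mono (by omega)), ?_, ?_⟩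
    · have hs' : LengthLE (d + 1) r := by
        simpa using ha.sub (hr.mono (Nat.sub_le _ _))
      have : ⁅A.left, B.left⁆ + A.right B.left - B.right A.left - ⁅r, s⁆ =
          ⁅A.left - r, B.left⁆ + ⁅r, B.left - s⁆ + A.right B.left - B.right A.left := by
        rw [sub_lie, lie_sub]; abel
      rw [this]
      exact ((((hr.lie hb).mono (by omega)).add ((hs'.lie hs).mono (by omega))).add
        (h1.mono (by omega))).sub (h2.mono (by omega))
    · intro m h hh
      rw [LieDerivation.lie_apply]
      exact (ha' _ _ (hb' _ _ hh)).sub (hb' _ _ (ha' _ _ hh))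

/-- The centralizer of a generator of a free Lie algebra is spanned by that generator. -/
theorem exists_eq_smul_of_lie_of_eq_zero {x : X} {z : FreeLieAlgebra R X}
    (h : ⁅z, of R x⁆ = 0) : ∃ c : R, z = c • of R x := by
  obtain ⟨d, hz⟩ := LengthLE.exists_lengthLE z
  induction d generalizing X with
  | zero => exact ⟨0, by simp [hz.eq_zero]⟩
  | succ d ih =>
    refine exists_eq_smul_of_kill_eq fun t ht => ?_
    have hx : elimIncl R t (of R ((⟨x, ht.symm⟩, 0) : ElimGen t)) = of R x := by simp [elimIncl]
    have hrx : elimRetract R t (of R x) = of R (⟨x, ht.symm⟩, 0) := by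
      simp [elimRetract, ht.symm]
    obtain ⟨c, g, hg⟩ := exists_eq_smul_add_elimIncl t z
    have hzs : elimSplit R t z = ⟨g, c • elimShift R t⟩ := by
      rw [hg, map_add, map_smul, elimSplit_of_self, elimSplit_elimIncl]
      simp
    have hcomm : ⁅g, of R ((⟨x, ht.symm⟩, 0) : ElimGen t)⁆ +
        c • of R ((⟨x, ht.symm⟩, 1) : ElimGen t) = 0 := by
      have := congrArg (fun w => (elimSplit R t w).left) h
      simpa [LieHom.map_lie, hzs, elimSplit_of_ne ht.symm, elimShift] using this
    have hc : c = 0 := by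
      classical
      let := LieRing.ofAssociativeRing (A := R)
      let := LieAlgebra.ofAssociativeAlgebra (A := R) (R := R)
      have := congrArg (lift R (Pi.single ((⟨x, ht.symm⟩, 1) : ElimGen t) (1 : R))) hcomm
      simpa [LieHom.map_lie, LieRing.of_associative_ring_bracket] using this
    subst hc
    rw [zero_smul, zero_add] at hg
    rw [zero_smul, add_zero] at hcomm
    have hr : ⁅elimRetract R t z, of R ((⟨x, ht.symm⟩, 0) : ElimGen t)⁆ = 0 := by
      rw [← hrx, ← LieHom.map_lie, h, map_zero]
    have hlen : LengthLE d (g - elimRetract R t z) := by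
      simpa [hzs] using (hz.elimSplit (t := t)).2.1
    obtain ⟨a, ha⟩ := ih (by rw [sub_lie, hcomm, hr, sub_zero]) hlen
    have h0 := congrArg (fun w => elimRetract R t (elimIncl R t w)) ha
    simp only [map_sub, map_smul, hx, hrx, ← hg, elimIncl_elimRetract, elimRetract_kill,
      sub_self] at h0
    rw [← h0, sub_eq_zero] at ha
    rw [← elimIncl_elimRetract, ← ha, ← hg]

theorem eq_zero_of_forall_lie_eq_zero [Nontrivial X] {z : FreeLieAlgebra R X}
    (h : ∀ x : X, ⁅z, of R x⁆ = 0) : z = 0 := by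
  obtain ⟨x, y, hxy⟩ := exists_pair_ne X
  obtain ⟨a, ha⟩ := exists_eq_smul_of_lie_of_eq_zero (h x)
  obtain ⟨b, hb⟩ := exists_eq_smul_of_lie_of_eq_zero (h y)
  have : a = 0 := eq_zero_of_smul_of_add_smul_of_eq_zero hxy (b := -b) (by
    rw [neg_smul, ← ha, ← hb, add_neg_cancel])
  rw [ha, this, zero_smul]

end Elimination

end FreeLieAlgebra

namespace FreeLieAlgebra

section Int

universe v w

variable {X : Type v} {M : Type w} [LieRing M]

theorem int_induction {p : FreeLieAlgebra ℤ X → Prop} (zero : p 0) (of : ∀ x, p (of ℤ x))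
    (add : ∀ a b, p a → p b → p (a + b)) (neg : ∀ a, p a → p (-a))
    (lie : ∀ a b, p a → p b → p ⁅a, b⁆) (z : FreeLieAlgebra ℤ X) : p z := by
  refine FreeLieAlgebra.induction zero of add (fun c a ha => ?_) lie z
  have h (c : ℤ) : p (c • a) := by
    induction c with
    | zero => rwa [zero_zsmul]
    | succ k ih => rw [add_zsmul, one_zsmul]; exact add _ _ ih ha
    | pred k ih => rw [sub_zsmul, one_zsmul]; exact add _ _ ih (neg _ ha)
  exact (congrArg p (int_smul_eq_zsmul _ c a)).mpr (h c)

/-- The lift of a map on generators, as a homomorphism for the canonical `ℤ`-module structure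
of the underlying additive group. -/
noncomputable def intLift (f : X → M) : FreeLieAlgebra ℤ X →ₗ⁅ℤ⁆ M where
  toFun := lift ℤ f
  map_add' := map_add (lift ℤ f)
  map_smul' := map_zsmul (lift ℤ f)
  map_lie' := LieHom.map_lie (lift ℤ f) _ _

@[simp]
theorem intLift_of (f : X → M) (x : X) : intLift f (of ℤ x) = f x :=
  lift_of_apply f x

theorem intHom_ext {φ ψ : FreeLieAlgebra ℤ X →ₗ⁅ℤ⁆ M} (h : ∀ x, φ (of ℤ x) = ψ (of ℤ x)) :
    φ = ψ := by
  refine LieHom.ext fun z => ?_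
  induction z using int_induction with
  | zero => simp
  | of x => exact h x
  | add a b ha hb => rw [map_add, map_add, ha, hb]
  | neg a ha => rw [map_neg, map_neg, ha]
  | lie a b ha hb => rw [LieHom.map_lie, LieHom.map_lie, ha, hb]

/-- The extension of a map on generators to a derivation, for the canonical `ℤ`-module structure
of the underlying additive group. -/
noncomputable def intDerivation (f : X → FreeLieAlgebra ℤ X) :
    LieDerivation ℤ (FreeLieAlgebra ℤ X) (FreeLieAlgebra ℤ X) where
  toFun := derivation f
  map_add' := map_add (derivation f)
  map_smul' := map_zsmul (derivation f)
  leibniz' := (derivation f).leibniz'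

@[simp]
theorem intDerivation_of (f : X → FreeLieAlgebra ℤ X) (x : X) :
    intDerivation f (of ℤ x) = f x :=
  derivation_of f x

theorem intDerivation_ext {D E : LieDerivation ℤ (FreeLieAlgebra ℤ X) (FreeLieAlgebra ℤ X)}
    (h : ∀ x, D (of ℤ x) = E (of ℤ x)) : D = E := by
  ext z
  induction z using int_induction with
  | zero => simp
  | of x => exact h x
  | add a b ha hb => rw [map_add, map_add, ha, hb]
  | neg a ha => rw [map_neg, map_neg, ha]
  | lie a b ha hb => rw [LieDerivation.apply_lie_eq_add, LieDerivation.apply_lie_eq_add, ha, hb]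

end Int

end FreeLieAlgebra

section PureBraid

variable {n : ℕ}

theorem Bpre_comm (i j : Fin n) : Bpre i j = Bpre j i := by
  unfold Bpre
  split_ifs with h h' <;> first | rfl | exact absurd h' h.not_gt

theorem Bq_comm (i j : Fin n) : Bq i j = Bq j i := by
  rw [Bq, Bpre_comm, Bq]

theorem Bq_of_lt {i j : Fin n} (h : i < j) :
    Bq i j = LieSubmodule.Quotient.mk' (pbIdeal n) (FreeLieAlgebra.of ℤ ⟨(i, j), h⟩) := by
  rw [Bq, Bpre, dif_pos h]

theorem Bq_self (i : Fin n) : Bq i i = 0 := by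
  simp [Bq, Bpre]

theorem lie_Bq_of_disjoint {i j s t : Fin n} (his : i ≠ s) (hit : i ≠ t) (hjs : j ≠ s)
    (hjt : j ≠ t) : ⁅Bq i j, Bq s t⁆ = 0 := by
  have : ⁅Bpre i j, Bpre s t⁆ ∈ pbIdeal n := by
    refine LieSubmodule.subset_lieSpan (Or.inl ⟨i, j, s, t, ?_, rfl⟩)
    ext x
    simp only [Set.mem_inter_iff, Set.mem_insert_iff, Set.mem_singleton_iff,
      Set.mem_empty_iff_false]
    grind
  exact (LieSubmodule.Quotient.mk_eq_zero _).2 this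

theorem lie_Bq_add {i j s : Fin n} (hij : i ≠ j) (hjs : j ≠ s) (his : i ≠ s) :
    ⁅Bq i j, Bq i s + Bq s j⁆ = 0 := by
  have : ⁅Bpre i j, Bpre i s + Bpre s j⁆ ∈ pbIdeal n :=
    LieSubmodule.subset_lieSpan (Or.inr ⟨i, j, s, hij, hjs, his, rfl⟩)
  exact (LieSubmodule.Quotient.mk_eq_zero _).2 this

namespace LnAlg

theorem induction {p : LnAlg n → Prop} (zero : p 0) (gen : ∀ i j, i ≠ j → p (Bq i j))
    (add : ∀ a b, p a → p b → p (a + b)) (neg : ∀ a, p a → p (-a))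
    (lie : ∀ a b, p a → p b → p ⁅a, b⁆) (z : LnAlg n) : p z := by
  obtain ⟨w, rfl⟩ := LieSubmodule.Quotient.surjective_mk' (pbIdeal n) z
  induction w using FreeLieAlgebra.int_induction with
  | zero => rwa [map_zero]
  | of x => rw [← Bq_of_lt x.2]; exact gen _ _ x.2.ne
  | add a b ha hb => rw [map_add]; exact add _ _ ha hb
  | neg a ha => rw [map_neg]; exact neg _ ha
  | lie a b ha hb => exact lie _ _ ha hb

/-- A family of elements of a Lie algebra satisfying the infinitesimal braid relations. -/
structure IsBraidFamily {M : Type*} [LieRing M] (F : Fin n → Fin n → M) : Prop where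
  comm : ∀ i j, F i j = F j i
  disjoint : ∀ i j s t, i ≠ j → s ≠ t → i ≠ s → i ≠ t → j ≠ s → j ≠ t → ⁅F i j, F s t⁆ = 0
  triple : ∀ i j s, i ≠ j → j ≠ s → i ≠ s → ⁅F i j, F i s + F s j⁆ = 0

variable {M : Type*} [LieRing M]

theorem IsBraidFamily.lift_Bpre {F : Fin n → Fin n → M} (hF : IsBraidFamily F) {i j : Fin n}
    (h : i ≠ j) : FreeLieAlgebra.intLift (fun p : PBGen n => F p.1.1 p.1.2) (Bpre i j) = F i j := by
  rcases h.lt_or_gt with h | h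
  · simp [Bpre, h]
  · simp [Bpre, h, h.not_gt, hF.comm i j]

theorem IsBraidFamily.pbIdeal_le_ker {F : Fin n → Fin n → M} (hF : IsBraidFamily F) :
    pbIdeal n ≤ (FreeLieAlgebra.intLift (fun p : PBGen n => F p.1.1 p.1.2)).ker := by
  refine LieSubmodule.lieSpan_le.2 ?_
  rintro x (⟨i, j, s, t, h, rfl⟩ | ⟨i, j, s, hij, hjs, his, rfl⟩) <;>
    refine LieHom.mem_ker.2 ?_ <;> rw [LieHom.map_lie]
  · by_cases hij : i = j
    · simp [hij, Bpre]
    by_cases hst : s = t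
    · simp [hst, Bpre]
    rw [hF.lift_Bpre hij, hF.lift_Bpre hst]
    have key (x : Fin n) (hx : x = i ∨ x = j) (hx' : x = s ∨ x = t) : False := by
      have : x ∈ ({i, j} ∩ {s, t} : Set (Fin n)) := ⟨hx, hx'⟩
      simp [h] at this
    exact hF.disjoint i j s t hij hst (fun h => key i (by simp) (by simp [h]))
      (fun h => key i (by simp) (by simp [h])) (fun h => key j (by simp) (by simp [h]))
      (fun h => key j (by simp) (by simp [h]))
  · rw [map_add, hF.lift_Bpre hij, hF.lift_Bpre his, hF.lift_Bpre hjs.symm]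
    exact hF.triple i j s hij hjs his

/-- The Lie algebra homomorphism out of `L(n)` defined by a family satisfying the infinitesimal
braid relations. -/
noncomputable def lift (F : Fin n → Fin n → M) (hF : IsBraidFamily F) : LnAlg n →ₗ⁅ℤ⁆ M :=
  { (pbIdeal n).toSubmodule.liftQ
      (FreeLieAlgebra.intLift fun p : PBGen n => F p.1.1 p.1.2).toLinearMap
      hF.pbIdeal_le_ker with
    map_lie' := by
      intro x y
      obtain ⟨x, rfl⟩ := LieSubmodule.Quotient.surjective_mk' (pbIdeal n) x
      obtain ⟨y, rfl⟩ := LieSubmodule.Quotient.surjective_mk' (pbIdeal n) y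
      exact LieHom.map_lie (FreeLieAlgebra.intLift (fun p : PBGen n => F p.1.1 p.1.2)) x y }

theorem lift_Bq {F : Fin n → Fin n → M} (hF : IsBraidFamily F) {i j : Fin n} (h : i ≠ j) :
    lift F hF (Bq i j) = F i j :=
  hF.lift_Bpre h

/-- The inclusion `L(n) → L(n + 1)` onto the strands other than the last one. -/
noncomputable def incl (n : ℕ) : LnAlg n →ₗ⁅ℤ⁆ LnAlg (n + 1) :=
  lift (fun i j => Bq i.castSucc j.castSucc)
    { comm := fun _ _ => Bq_comm _ _
      disjoint := fun i j s t _ _ h₁ h₂ h₃ h₄ => lie_Bq_of_disjoint (by simpa) (by simpa)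
        (by simpa) (by simpa)
      triple := fun i j s h₁ h₂ h₃ => lie_Bq_add (by simpa) (by simpa) (by simpa) }

theorem incl_Bq (i j : Fin n) : incl n (Bq i j) = Bq i.castSucc j.castSucc := by
  by_cases h : i = j
  · simp [h, Bq_self]
  · exact lift_Bq _ h

/-- The projection `L(n + 1) → L(n)` forgetting the last strand. -/
noncomputable def forget (n : ℕ) : LnAlg (n + 1) →ₗ⁅ℤ⁆ LnAlg n :=
  lift (fun i j => Fin.lastCases 0 (fun i => Fin.lastCases 0 (fun j => Bq i j) j) i)
    { comm := fun i j => by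
        induction i using Fin.lastCases <;> induction j using Fin.lastCases <;>
          simp [Bq_comm]
      disjoint := fun i j s t _ _ h₁ h₂ h₃ h₄ => by
        induction i using Fin.lastCases <;> induction j using Fin.lastCases <;>
          induction s using Fin.lastCases <;> induction t using Fin.lastCases <;>
          simp_all [lie_Bq_of_disjoint]
      triple := fun i j s h₁ h₂ h₃ => by
        induction i using Fin.lastCases <;> induction j using Fin.lastCases <;>
          induction s using Fin.lastCases <;> simp_all [lie_Bq_add, -lie_add] }

theorem forget_incl (z : LnAlg n) : forget n (incl n z) = z := by
  induction z using LnAlg.induction with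
  | zero => simp
  | gen i j h => rw [incl_Bq, forget, lift_Bq _ (by simpa)]; simp
  | add a b ha hb => rw [map_add, map_add, ha, hb]
  | neg a ha => rw [map_neg, map_neg, ha]
  | lie a b ha hb => rw [LieHom.map_lie, LieHom.map_lie, ha, hb]

/-- The homomorphism from the free Lie algebra to `L(n + 1)` sending the generators to the
`B_{i, n + 1}`. -/
noncomputable def fiber (n : ℕ) : FreeLieAlgebra ℤ (Fin n) →ₗ⁅ℤ⁆ LnAlg (n + 1) :=
  FreeLieAlgebra.intLift fun i => Bq i.castSucc (Fin.last n)

theorem fiber_of (i : Fin n) : fiber n (of ℤ i) = Bq i.castSucc (Fin.last n) := by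
  simp [fiber]

theorem forget_fiber (f : FreeLieAlgebra ℤ (Fin n)) : forget n (fiber n f) = 0 := by
  have : (forget n).comp (fiber n) = 0 := by
    refine FreeLieAlgebra.intHom_ext fun i => ?_
    rw [LieHom.comp_apply, fiber_of, forget, lift_Bq _ (Fin.castSucc_ne_last i)]
    simp
  exact LieHom.congr_fun this f

/-- The derivation of the free Lie algebra on the last strand given by `ad B_{i,j}`. -/
noncomputable def fiberDer (i j : Fin n) :
    LieDerivation ℤ (FreeLieAlgebra ℤ (Fin n)) (FreeLieAlgebra ℤ (Fin n)) :=
  FreeLieAlgebra.intDerivation fun k =>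
    (if k = i then ⁅of ℤ i, of ℤ j⁆ else 0) + (if k = j then ⁅of ℤ j, of ℤ i⁆ else 0)

theorem fiberDer_comm (i j : Fin n) : fiberDer i j = fiberDer j i := by
  simp only [fiberDer, add_comm]

theorem fiberDer_of_ne {i j k : Fin n} (hi : k ≠ i) (hj : k ≠ j) :
    fiberDer i j (of ℤ k) = 0 := by
  simp [fiberDer, hi, hj]

theorem fiberDer_of_left (i j : Fin n) : fiberDer i j (of ℤ i) = ⁅of ℤ i, of ℤ j⁆ := by
  by_cases h : i = j <;> simp [fiberDer, h]

theorem fiberDer_of_right (i j : Fin n) : fiberDer i j (of ℤ j) = ⁅of ℤ j, of ℤ i⁆ := by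
  rw [fiberDer_comm, fiberDer_of_left]

theorem lie_fiberDer_of_disjoint {i j s t : Fin n} (his : i ≠ s) (hit : i ≠ t) (hjs : j ≠ s)
    (hjt : j ≠ t) : ⁅fiberDer i j, fiberDer s t⁆ = 0 := by
  have h₁ := fiberDer_of_ne his hit
  have h₂ := fiberDer_of_ne hjs hjt
  have h₃ := fiberDer_of_ne his.symm hjs.symm
  have h₄ := fiberDer_of_ne hit.symm hjt.symm
  refine FreeLieAlgebra.intDerivation_ext fun k => ?_
  rw [LieDerivation.lie_apply, LieDerivation.zero_apply]
  by_cases hki : k = i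
  · subst hki; simp [h₁, h₂, fiberDer_of_left]
  by_cases hkj : k = j
  · subst hkj; simp [h₁, h₂, fiberDer_of_right]
  by_cases hks : k = s
  · subst hks; simp [h₃, h₄, fiberDer_of_left]
  by_cases hkt : k = t
  · subst hkt; simp [h₃, h₄, fiberDer_of_right]
  simp [fiberDer_of_ne, *]

theorem lie_fiberDer_add {i j s : Fin n} (hij : i ≠ j) (hjs : j ≠ s) (his : i ≠ s) :
    ⁅fiberDer i j, fiberDer i s + fiberDer s j⁆ = 0 := by
  have h₁ := fiberDer_of_ne his.symm hjs.symm
  have h₂ := fiberDer_of_ne hij.symm hjs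
  have h₃ := fiberDer_of_ne his hij
  refine FreeLieAlgebra.intDerivation_ext fun k => ?_
  rw [LieDerivation.lie_apply, LieDerivation.zero_apply]
  by_cases hki : k = i
  · subst hki
    simp only [LieDerivation.add_apply, LieDerivation.apply_lie_eq_add, fiberDer_of_left,
      fiberDer_of_right, h₁, h₂, h₃, lie_zero, add_zero, zero_add]
    rw [leibniz_lie (of ℤ k) (of ℤ j), ← lie_skew ⁅of ℤ k, of ℤ s⁆ (of ℤ j)]
    abel
  by_cases hkj : k = j
  · subst hkj
    simp only [LieDerivation.add_apply, LieDerivation.apply_lie_eq_add, fiberDer_of_left,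
      fiberDer_of_right, h₁, h₂, h₃, lie_zero, add_zero, zero_add]
    rw [leibniz_lie (of ℤ k) (of ℤ i), ← lie_skew ⁅of ℤ k, of ℤ s⁆ (of ℤ i)]
    abel
  by_cases hks : k = s
  · subst hks
    simp only [LieDerivation.add_apply, LieDerivation.apply_lie_eq_add, map_add,
      fiberDer_of_left, fiberDer_of_right, h₁, map_zero, zero_lie, add_zero]
    rw [← lie_skew (of ℤ j) (of ℤ i), lie_neg]
    abel
  simp [fiberDer_of_ne, *]

/-- The derivations of the free Lie algebra on the last strand by which the generators of
`L(n + 1)` act. -/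
noncomputable def fiberAction (i j : Fin (n + 1)) :
    LieDerivation ℤ (FreeLieAlgebra ℤ (Fin n)) (FreeLieAlgebra ℤ (Fin n)) :=
  Fin.lastCases (Fin.lastCases 0 (fun j => LieDerivation.ad ℤ _ (of ℤ j)) j)
    (fun i => Fin.lastCases (LieDerivation.ad ℤ _ (of ℤ i)) (fun j => fiberDer i j) j) i

@[simp]
theorem fiberAction_castSucc (i j : Fin n) :
    fiberAction i.castSucc j.castSucc = fiberDer i j := by
  simp [fiberAction]

@[simp]
theorem fiberAction_castSucc_last (i : Fin n) :
    fiberAction i.castSucc (Fin.last n) = LieDerivation.ad ℤ _ (of ℤ i) := by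
  simp [fiberAction]

@[simp]
theorem fiberAction_last_castSucc (i : Fin n) :
    fiberAction (Fin.last n) i.castSucc = LieDerivation.ad ℤ _ (of ℤ i) := by
  simp [fiberAction]

theorem fiberAction_comm (i j : Fin (n + 1)) : fiberAction i j = fiberAction j i := by
  induction i using Fin.lastCases <;> induction j using Fin.lastCases <;>
    simp [fiberDer_comm]

theorem lie_fiberDer_ad_of_ne {i j k : Fin n} (hi : k ≠ i) (hj : k ≠ j) :
    ⁅fiberDer i j, LieDerivation.ad ℤ _ (of ℤ k)⁆ = 0 := by
  rw [LieDerivation.lie_der_ad_eq_ad_der, fiberDer_of_ne hi hj, map_zero]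

theorem lie_fiberAction_of_disjoint {i j s t : Fin (n + 1)} (hij : i ≠ j) (hst : s ≠ t)
    (his : i ≠ s) (hit : i ≠ t) (hjs : j ≠ s) (hjt : j ≠ t) :
    ⁅fiberAction i j, fiberAction s t⁆ = 0 := by
  have key (i j k : Fin n) (hi : k ≠ i) (hj : k ≠ j) :
      ⁅LieDerivation.ad ℤ _ (of ℤ k), fiberDer i j⁆ = 0 := by
    rw [← lie_skew, lie_fiberDer_ad_of_ne hi hj, neg_zero]
  cases i using Fin.lastCases with
  | last =>
    obtain ⟨j, rfl⟩ := Fin.exists_castSucc_eq.2 hij.symm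
    obtain ⟨s, rfl⟩ := Fin.exists_castSucc_eq.2 his.symm
    obtain ⟨t, rfl⟩ := Fin.exists_castSucc_eq.2 hit.symm
    rw [fiberAction_last_castSucc, fiberAction_castSucc]
    exact key _ _ _ (by simpa using hjs) (by simpa using hjt)
  | cast i =>
    cases j using Fin.lastCases with
    | last =>
      obtain ⟨s, rfl⟩ := Fin.exists_castSucc_eq.2 hjs.symm
      obtain ⟨t, rfl⟩ := Fin.exists_castSucc_eq.2 hjt.symm
      rw [fiberAction_castSucc_last, fiberAction_castSucc]
      exact key _ _ _ (by simpa using his) (by simpa using hit)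
    | cast j =>
      cases s using Fin.lastCases with
      | last =>
        obtain ⟨t, rfl⟩ := Fin.exists_castSucc_eq.2 hst.symm
        rw [fiberAction_last_castSucc, fiberAction_castSucc]
        exact lie_fiberDer_ad_of_ne (by simpa using hit.symm) (by simpa using hjt.symm)
      | cast s =>
        cases t using Fin.lastCases with
        | last =>
          rw [fiberAction_castSucc_last, fiberAction_castSucc]
          exact lie_fiberDer_ad_of_ne (by simpa using his.symm) (by simpa using hjs.symm)
        | cast t =>
          rw [fiberAction_castSucc, fiberAction_castSucc]
          exact lie_fiberDer_of_disjoint (by simpa using his) (by simpa using hit)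
            (by simpa using hjs) (by simpa using hjt)

theorem lie_fiberAction_add {i j s : Fin (n + 1)} (hij : i ≠ j) (hjs : j ≠ s) (his : i ≠ s) :
    ⁅fiberAction i j, fiberAction i s + fiberAction s j⁆ = 0 := by
  have key (i s : Fin n) :
      ⁅LieDerivation.ad ℤ (FreeLieAlgebra ℤ (Fin n)) (of ℤ i),
        fiberDer i s + LieDerivation.ad ℤ _ (of ℤ s)⁆ = 0 := by
    rw [lie_add, ← lie_skew, LieDerivation.lie_der_ad_eq_ad_der, fiberDer_of_left,
      LieHom.map_lie, neg_add_cancel]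
  cases i using Fin.lastCases with
  | last =>
    obtain ⟨j, rfl⟩ := Fin.exists_castSucc_eq.2 hij.symm
    obtain ⟨s, rfl⟩ := Fin.exists_castSucc_eq.2 his.symm
    rw [fiberAction_last_castSucc, fiberAction_last_castSucc, fiberAction_castSucc, add_comm,
      fiberDer_comm]
    exact key j s
  | cast i =>
    cases j using Fin.lastCases with
    | last =>
      obtain ⟨s, rfl⟩ := Fin.exists_castSucc_eq.2 hjs.symm
      rw [fiberAction_castSucc_last, fiberAction_castSucc_last, fiberAction_castSucc]
      exact key i s
    | cast j =>
      cases s using Fin.lastCases with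
      | last =>
        rw [fiberAction_castSucc_last, fiberAction_last_castSucc, fiberAction_castSucc, lie_add,
          LieDerivation.lie_der_ad_eq_ad_der, LieDerivation.lie_der_ad_eq_ad_der,
          fiberDer_of_left, fiberDer_of_right, ← map_add, ← lie_skew, neg_add_cancel, map_zero]
      | cast s =>
        simp only [fiberAction_castSucc]
        exact lie_fiberDer_add (by simpa using hij) (by simpa using hjs) (by simpa using his)

/-- The action of `L(n + 1)` on the free Lie algebra on the last strand. -/
noncomputable def fiberRep (n : ℕ) : LnAlg (n + 1) →ₗ⁅ℤ⁆
    LieDerivation ℤ (FreeLieAlgebra ℤ (Fin n)) (FreeLieAlgebra ℤ (Fin n)) :=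
  lift fiberAction
    { comm := fiberAction_comm
      disjoint := fun _ _ _ _ => lie_fiberAction_of_disjoint
      triple := fun _ _ _ => lie_fiberAction_add }

theorem fiberRep_fiber (f : FreeLieAlgebra ℤ (Fin n)) :
    fiberRep n (fiber n f) = LieDerivation.ad ℤ _ f := by
  have : (fiberRep n).comp (fiber n) = LieDerivation.ad ℤ _ := by
    refine FreeLieAlgebra.intHom_ext fun i => ?_
    rw [LieHom.comp_apply, fiber_of, fiberRep, lift_Bq _ (Fin.castSucc_ne_last i),
      fiberAction_castSucc_last]
  exact LieHom.congr_fun this f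

theorem fiberRep_incl_Bq {i j : Fin n} (h : i ≠ j) :
    fiberRep n (incl n (Bq i j)) = fiberDer i j := by
  rw [incl_Bq, fiberRep, lift_Bq _ (by simpa), fiberAction_castSucc]

theorem lie_incl_Bq_fiber_of_left {i j : Fin n} (h : i ≠ j) :
    ⁅incl n (Bq i j), fiber n (of ℤ i)⁆ = ⁅fiber n (of ℤ i), fiber n (of ℤ j)⁆ := by
  have := lie_Bq_add (i := i.castSucc) (j := Fin.last n) (s := j.castSucc)
    (Fin.castSucc_ne_last i) (Fin.castSucc_ne_last j).symm (by simpa)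
  rw [lie_add, ← incl_Bq, ← fiber_of, ← fiber_of, ← lie_skew, neg_add_eq_zero] at this
  exact this

theorem lie_incl_Bq_fiber_of_right {i j : Fin n} (h : i ≠ j) :
    ⁅incl n (Bq i j), fiber n (of ℤ j)⁆ = ⁅fiber n (of ℤ j), fiber n (of ℤ i)⁆ := by
  rw [Bq_comm, lie_incl_Bq_fiber_of_left h.symm]

theorem lie_incl_Bq_fiber_of_ne {i j k : Fin n} (hi : k ≠ i) (hj : k ≠ j) :
    ⁅incl n (Bq i j), fiber n (of ℤ k)⁆ = 0 := by
  rw [incl_Bq, fiber_of]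
  exact lie_Bq_of_disjoint (by simpa using hi.symm) (Fin.castSucc_ne_last i)
    (by simpa using hj.symm) (Fin.castSucc_ne_last j)

theorem lie_incl_fiber (y : LnAlg n) (f : FreeLieAlgebra ℤ (Fin n)) :
    ⁅incl n y, fiber n f⁆ = fiber n (fiberRep n (incl n y) f) := by
  induction y using LnAlg.induction generalizing f with
  | zero => simp
  | gen i j h =>
    rw [fiberRep_incl_Bq h]
    induction f using FreeLieAlgebra.int_induction with
    | zero => simp
    | of k =>
      by_cases hi : k = i
      · subst hi; rw [fiberDer_of_left, LieHom.map_lie, lie_incl_Bq_fiber_of_left h]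
      by_cases hj : k = j
      · subst hj; rw [fiberDer_of_right, LieHom.map_lie, lie_incl_Bq_fiber_of_right h]
      rw [fiberDer_of_ne hi hj, map_zero, lie_incl_Bq_fiber_of_ne hi hj]
    | add a b ha hb => rw [map_add, lie_add, ha, hb, map_add, map_add]
    | neg a ha => rw [map_neg, lie_neg, ha, map_neg, map_neg]
    | lie a b ha hb =>
      rw [LieDerivation.apply_lie_eq_add, map_add, LieHom.map_lie, LieHom.map_lie, LieHom.map_lie,
        leibniz_lie, ha, hb]
      exact add_comm _ _
  | add a b ha hb => simp only [map_add, add_lie, ha, hb, LieDerivation.add_apply]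
  | neg a ha => simp only [map_neg, neg_lie, ha, LieDerivation.neg_apply]
  | lie a b ha hb =>
    rw [LieHom.map_lie, lie_lie, hb, ha, ha, hb, LieHom.map_lie, LieDerivation.lie_apply, map_sub]

theorem exists_eq_incl_add_fiber (z : LnAlg (n + 1)) :
    ∃ (y : LnAlg n) (f : FreeLieAlgebra ℤ (Fin n)), z = incl n y + fiber n f := by
  induction z using LnAlg.induction with
  | zero => exact ⟨0, 0, by simp⟩
  | gen i j h =>
    induction i using Fin.lastCases with
    | last =>
      induction j using Fin.lastCases with
      | last => exact absurd rfl h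
      | cast j => exact ⟨0, of ℤ j, by rw [fiber_of, Bq_comm]; simp⟩
    | cast i =>
      induction j using Fin.lastCases with
      | last => exact ⟨0, of ℤ i, by rw [fiber_of]; simp⟩
      | cast j => exact ⟨Bq i j, 0, by rw [incl_Bq]; simp⟩
  | add a b ha hb =>
    obtain ⟨y, f, rfl⟩ := ha
    obtain ⟨y', f', rfl⟩ := hb
    exact ⟨y + y', f + f', by rw [map_add, map_add]; abel⟩
  | neg a ha =>
    obtain ⟨y, f, rfl⟩ := ha
    exact ⟨-y, -f, by rw [map_neg, map_neg, neg_add]⟩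
  | lie a b ha hb =>
    obtain ⟨y, f, rfl⟩ := ha
    obtain ⟨y', f', rfl⟩ := hb
    refine ⟨⁅y, y'⁆, fiberRep n (incl n y) f' - fiberRep n (incl n y') f + ⁅f, f'⁆, ?_⟩
    rw [map_add, map_sub, LieHom.map_lie, LieHom.map_lie, ← lie_incl_fiber, ← lie_incl_fiber,
      ← lie_skew _ (fiber n f), lie_add, add_lie, add_lie]
    abel

end LnAlg

theorem Delta_eq_sum (n : ℕ) : Delta n = ∑ i, ∑ j, if i < j then Bq i j else 0 := by
  rw [← Fintype.sum_prod_type' (f := fun i j : Fin n => if i < j then Bq i j else (0 : LnAlg n)),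
    ← Finset.sum_filter, Finset.sum_subtype _ (p := fun p : Fin n × Fin n => p.1 < p.2) (by simp)]
  exact Finset.sum_congr rfl fun p _ => (Bq_of_lt p.2).symm

theorem Delta_succ (n : ℕ) :
    Delta (n + 1) = LnAlg.incl n (Delta n) + LnAlg.fiber n (∑ i, of ℤ i) := by
  rw [Delta_eq_sum, Delta_eq_sum, Fin.sum_univ_castSucc]
  simp [Fin.sum_univ_castSucc, LnAlg.fiber_of, LnAlg.incl_Bq, Finset.sum_add_distrib,
    apply_ite (LnAlg.incl n), Fin.castSucc_lt_last, (Fin.castSucc_lt_last _).not_gt]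

theorem lie_Delta (z : LnAlg n) : ⁅z, Delta n⁆ = 0 := by
  induction n with
  | zero => simp [Delta]
  | succ n ih =>
    have hof (k : Fin n) : ⁅LnAlg.fiber n (of ℤ k), Delta (n + 1)⁆ = 0 := by
      have h₁ (i j : Fin n) (hij : i < j) :
          ⁅LnAlg.fiber n (of ℤ k), LnAlg.incl n (Bq i j)⁆ =
            (if i = k then ⁅LnAlg.fiber n (of ℤ j), LnAlg.fiber n (of ℤ k)⁆ else 0) +
            (if j = k then ⁅LnAlg.fiber n (of ℤ i), LnAlg.fiber n (of ℤ k)⁆ else 0) := by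
        rw [← lie_skew]
        by_cases hi : i = k
        · subst hi
          rw [LnAlg.lie_incl_Bq_fiber_of_left hij.ne, lie_skew]
          simp [hij.ne']
        by_cases hj : j = k
        · subst hj
          rw [LnAlg.lie_incl_Bq_fiber_of_right hij.ne, lie_skew]
          simp [hi]
        rw [LnAlg.lie_incl_Bq_fiber_of_ne (Ne.symm hi) (Ne.symm hj)]
        simp [hi, hj]
      have h₂ : ⁅LnAlg.fiber n (of ℤ k), LnAlg.incl n (Delta n)⁆ =
          ∑ i, ⁅LnAlg.fiber n (of ℤ i), LnAlg.fiber n (of ℤ k)⁆ := by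
        have (i j : Fin n) :
            ⁅LnAlg.fiber n (of ℤ k), LnAlg.incl n (if i < j then Bq i j else 0)⁆ =
            (if i = k then (if k < j then ⁅LnAlg.fiber n (of ℤ j), LnAlg.fiber n (of ℤ k)⁆ else 0)
              else 0) +
            (if j = k then (if i < k then ⁅LnAlg.fiber n (of ℤ i), LnAlg.fiber n (of ℤ k)⁆ else 0)
              else 0) := by
          by_cases hij : i < j
          · rw [if_pos hij, h₁ i j hij]
            grind
          · rw [if_neg hij, map_zero, lie_zero]
            grind
        rw [Delta_eq_sum]
        simp only [map_sum, lie_sum, this, Finset.sum_add_distrib]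
        rw [Finset.sum_comm]
        simp only [Finset.sum_ite_eq', Finset.mem_univ, if_true, ← Finset.sum_add_distrib]
        refine Finset.sum_congr rfl fun i _ => ?_
        rcases lt_trichotomy i k with h | rfl | h
        · simp [h, h.not_gt]
        · simp
        · simp [h, h.not_gt]
      rw [Delta_succ, lie_add, h₂, ← lie_skew, map_sum, sum_lie, add_neg_cancel]
    have hincl (y : LnAlg n) : ⁅LnAlg.incl n y, Delta (n + 1)⁆ = 0 := by
      induction y using LnAlg.induction with
      | zero => simp
      | gen i j h =>
        rw [Delta_succ, lie_add, ← LieHom.map_lie, ih, map_zero, zero_add, map_sum, lie_sum,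
          ← Finset.add_sum_erase _ _ (Finset.mem_univ i), ← Finset.add_sum_erase _ _
          (show j ∈ Finset.univ.erase i by simp [h.symm]), Finset.sum_eq_zero,
          LnAlg.lie_incl_Bq_fiber_of_left h, LnAlg.lie_incl_Bq_fiber_of_right h, add_zero,
          ← lie_skew, neg_add_cancel]
        intro k hk
        exact LnAlg.lie_incl_Bq_fiber_of_ne (by grind) (by grind)
      | add a b ha hb => rw [map_add, add_lie, ha, hb, add_zero]
      | neg a ha => rw [map_neg, neg_lie, ha, neg_zero]
      | lie a b ha hb => rw [LieHom.map_lie, lie_lie, ha, hb, lie_zero, lie_zero, sub_zero]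
    induction z using LnAlg.induction with
    | zero => simp
    | gen i j h =>
      induction i using Fin.lastCases with
      | last =>
        induction j using Fin.lastCases with
        | last => exact absurd rfl h
        | cast j => rw [Bq_comm, ← LnAlg.fiber_of]; exact hof j
      | cast i =>
        induction j using Fin.lastCases with
        | last => rw [← LnAlg.fiber_of]; exact hof i
        | cast j => rw [← LnAlg.incl_Bq]; exact hincl _
    | add a b ha hb => rw [add_lie, ha, hb, add_zero]
    | neg a ha => rw [neg_lie, ha, neg_zero]
    | lie a b ha hb => rw [lie_lie, ha, hb, lie_zero, lie_zero, sub_zero]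

theorem eq_zero_of_fiber_central [Nontrivial (Fin n)] {f : FreeLieAlgebra ℤ (Fin n)}
    (h : ∀ z : LnAlg (n + 1), ⁅LnAlg.fiber n f, z⁆ = 0) : f = 0 := by
  refine FreeLieAlgebra.eq_zero_of_forall_lie_eq_zero fun i =>
    FreeLieAlgebra.eq_zero_of_forall_lie_eq_zero fun j => ?_
  have := congrArg (LnAlg.fiberRep n) (h (LnAlg.fiber n (of ℤ i)))
  rw [← LieHom.map_lie, LnAlg.fiberRep_fiber, map_zero] at this
  simpa only [LieDerivation.ad_apply_apply, LieDerivation.zero_apply] using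
    LieDerivation.congr_fun this (of ℤ j)

theorem exists_eq_smul_Delta_two (z : LnAlg 2) : ∃ c : ℤ, z = c • Delta 2 := by
  have h01 : Delta 2 = Bq 0 1 := by simp [Delta_eq_sum, Fin.sum_univ_two]
  induction z using LnAlg.induction with
  | zero => exact ⟨0, by simp⟩
  | gen i j h =>
    refine ⟨1, ?_⟩
    rw [one_smul, h01]
    fin_cases i <;> fin_cases j
    · exact absurd rfl h
    · rfl
    · exact Bq_comm 1 0
    · exact absurd rfl h
  | add a b ha hb =>
    obtain ⟨c, rfl⟩ := ha
    obtain ⟨d, rfl⟩ := hb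
    exact ⟨c + d, (add_smul _ _ _).symm⟩
  | neg a ha =>
    obtain ⟨d, rfl⟩ := ha
    exact ⟨-d, (neg_smul _ _).symm⟩
  | lie a b ha hb =>
    obtain ⟨c, rfl⟩ := ha
    exact ⟨0, by rw [← lie_skew, lie_smul, lie_Delta]; simp⟩

theorem exists_eq_smul_Delta_of_central (hn : 1 ≤ n) {z : LnAlg (n + 1)}
    (hz : ∀ y : LnAlg (n + 1), ⁅z, y⁆ = 0) : ∃ c : ℤ, z = c • Delta (n + 1) := by
  induction n, hn using Nat.le_induction with
  | base => exact exists_eq_smul_Delta_two z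
  | succ n hn ih =>
    obtain ⟨y, f, rfl⟩ := LnAlg.exists_eq_incl_add_fiber z
    obtain ⟨c, rfl⟩ := ih (z := y) fun w => by
      have := congrArg (LnAlg.forget (n + 1)) (hz (LnAlg.incl (n + 1) w))
      rwa [LieHom.map_lie, map_add, LnAlg.forget_incl, LnAlg.forget_incl, LnAlg.forget_fiber,
        add_zero, map_zero] at this
    have key : LnAlg.incl (n + 1) (c • Delta (n + 1)) + LnAlg.fiber (n + 1) f =
        c • Delta (n + 1 + 1) + LnAlg.fiber (n + 1) (f - c • ∑ i, of ℤ i) := by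
      rw [Delta_succ (n + 1), map_smul, map_sub, map_smul, smul_add]
      abel
    refine ⟨c, ?_⟩
    rw [key] at hz ⊢
    have : Nontrivial (Fin (n + 1)) := Fin.nontrivial_iff_two_le.2 (by omega)
    rw [eq_zero_of_fiber_central (f := f - c • ∑ i, of ℤ i) fun w => ?_, map_zero, add_zero]
    have := hz w
    rwa [add_lie, smul_lie, ← lie_skew, lie_Delta, neg_zero, smul_zero, zero_add] at this

theorem eq_zero_of_smul_Delta_eq_zero (hn : 2 ≤ n) {c : ℤ} (h : c • Delta n = 0) : c = 0 := by
  let := LieRing.ofAssociativeRing (A := ℤ)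
  let := LieAlgebra.ofAssociativeAlgebra (A := ℤ) (R := ℤ)
  let φ : LnAlg n →ₗ⁅ℤ⁆ ℤ := LnAlg.lift (fun _ _ => 1)
    { comm := fun _ _ => rfl
      disjoint := fun _ _ _ _ _ _ _ _ _ _ => by simp
      triple := fun _ _ _ _ _ _ => by simp [LieRing.of_associative_ring_bracket] }
  have hφ : φ (Delta n) = Fintype.card (PBGen n) := by
    rw [Delta, map_sum, Finset.sum_congr rfl fun p _ =>
      show _ = (1 : ℤ) by rw [← Bq_of_lt p.2]; exact LnAlg.lift_Bq _ p.2.ne]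
    simp
  have : Nonempty (PBGen n) := ⟨⟨(⟨0, by omega⟩, ⟨1, by omega⟩), by simp⟩⟩
  have hc := congrArg φ h
  rw [map_smul, hφ, map_zero, smul_eq_mul, mul_eq_zero] at hc
  exact hc.resolve_right (by exact_mod_cast Fintype.card_ne_zero)

end PureBraid

/-- For `n + 1 > 2`, the kernel of the adjoint representation, i.e. the center of
`L(n+1)`, is the ℤ-span of `Δ(n+1)`, free abelian of rank 1 in degree 1. -/
theorem center_eq_span_delta (n : ℕ) (hn : 2 ≤ n) :
    {x : LnAlg (n + 1) | ∀ y : LnAlg (n + 1), ⁅x, y⁆ = 0} =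
      ↑(Submodule.span ℤ {Delta (n + 1)}) ∧
    ∀ c : ℤ, c • Delta (n + 1) = 0 → c = 0 := by
  refine ⟨?_, fun c hc => eq_zero_of_smul_Delta_eq_zero (by omega) hc⟩
  ext x
  rw [Set.mem_ofPred_eq, SetLike.mem_coe, Submodule.mem_span_singleton]
  constructor
  · intro hx
    obtain ⟨c, rfl⟩ := exists_eq_smul_Delta_of_central (by omega) hx
    exact ⟨c, rfl⟩
  · rintro ⟨c, rfl⟩ y
    rw [smul_lie, ← lie_skew, lie_Delta, neg_zero, smul_zero]
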